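/- Let D be connected and let L be a two-dimensional weakly Kähler complex Finsler metric on D satisfying the weak symmetry condition R_{r̄kh̄s}η̄^rη̄^hη^s = R_{r̄sh̄k}η̄^rη^sη̄^h (for k ∈ {1,2}) at every point of D, with A nowhere zero on D. Then the horizontal curvature invariant K is constant on D. -/

import Mathlib

open Complex

noncomputable section

namespace CFinsler

/-- A point of `T'M` in local coordinates: `(z, η) ∈ ℂⁿ × ℂⁿ`. -/
abbrev Pt (n : ℕ) := (Fin n → ℂ) × (Fin n → ℂ)

variable {n : ℕ}

/-- Wirtinger derivative `∂f/∂z^k`. -/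
def dz (f : Pt n → ℂ) (k : Fin n) (p : Pt n) : ℂ :=
  (1 / 2) * (fderiv ℝ f p ((Pi.single k 1 : Fin n → ℂ), 0) -
    Complex.I * fderiv ℝ f p ((Pi.single k Complex.I : Fin n → ℂ), 0))

/-- Wirtinger derivative `∂f/∂z̄^k`. -/
def dzbar (f : Pt n → ℂ) (k : Fin n) (p : Pt n) : ℂ :=
  (1 / 2) * (fderiv ℝ f p ((Pi.single k 1 : Fin n → ℂ), 0) +
    Complex.I * fderiv ℝ f p ((Pi.single k Complex.I : Fin n → ℂ), 0))

/-- Wirtinger derivative `∂f/∂η^k`. -/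
def de (f : Pt n → ℂ) (k : Fin n) (p : Pt n) : ℂ :=
  (1 / 2) * (fderiv ℝ f p (0, (Pi.single k 1 : Fin n → ℂ)) -
    Complex.I * fderiv ℝ f p (0, (Pi.single k Complex.I : Fin n → ℂ)))

/-- Wirtinger derivative `∂f/∂η̄^k`. -/
def debar (f : Pt n → ℂ) (k : Fin n) (p : Pt n) : ℂ :=
  (1 / 2) * (fderiv ℝ f p (0, (Pi.single k 1 : Fin n → ℂ)) +
    Complex.I * fderiv ℝ f p (0, (Pi.single k Complex.I : Fin n → ℂ)))

/-- The fundamental metric tensor `g_{i j̄} := ∂²L/∂η^i ∂η̄^j`. -/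
def gm (L : Pt n → ℂ) (i j : Fin n) : Pt n → ℂ := de (debar L j) i

/-- `L` is an `n`-dimensional complex Finsler metric on `D`. -/
structure IsCFM (n : ℕ) (D : Set (Pt n)) (L : Pt n → ℂ) : Prop where
  openD : IsOpen D
  fiber_ne : ∀ p ∈ D, p.2 ≠ 0
  conic : ∀ p ∈ D, ∀ lam : ℂ, lam ≠ 0 → (p.1, lam • p.2) ∈ D
  smooth : ContDiffOn ℝ (⊤ : ℕ∞) L D
  real_im : ∀ p ∈ D, (L p).im = 0
  pos : ∀ p ∈ D, 0 < (L p).re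
  homog : ∀ p ∈ D, ∀ lam : ℂ, lam ≠ 0 →
    L (p.1, lam • p.2) = ((Complex.normSq lam : ℝ) : ℂ) * L p
  hermitian : ∀ p ∈ D, ∀ i j, (starRingEnd ℂ) (gm L i j p) = gm L j i p
  posdef : ∀ p ∈ D, ∀ v : Fin n → ℂ, v ≠ 0 →
    0 < (∑ i, ∑ j, gm L i j p * v i * (starRingEnd ℂ) (v j)).re

variable (L : Pt n → ℂ)

/-- The metric tensor as a matrix at a point. -/
def gmat (p : Pt n) : Matrix (Fin n) (Fin n) ℂ := fun i j => gm L i j p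

/-- The inverse metric tensor `g^{l̄ i}`. -/
def gi (l i : Fin n) (p : Pt n) : ℂ := (gmat L p)⁻¹ l i

/-- The Chern–Finsler nonlinear connection coefficients
`N^i_k := g^{m̄ i} (∂g_{l m̄}/∂z^k) η^l`. -/
def Nc (i k : Fin n) (p : Pt n) : ℂ :=
  ∑ m, ∑ l, gi L m i p * dz (gm L l m) k p * p.2 l

/-- The horizontal derivation `δ_k := ∂/∂z^k − N^j_k ∂/∂η^j`. -/
def del (f : Pt n → ℂ) (k : Fin n) (p : Pt n) : ℂ :=
  dz f k p - ∑ j, Nc L j k p * de f j p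

/-- The conjugate horizontal derivation `δ_k̄ := ∂/∂z̄^k − N̄^j_k ∂/∂η̄^j`. -/
def delbar (f : Pt n → ℂ) (k : Fin n) (p : Pt n) : ℂ :=
  dzbar f k p - ∑ j, (starRingEnd ℂ) (Nc L j k p) * debar f j p

/-- The horizontal Chern–Finsler connection coefficients `L^i_{jk} := g^{l̄ i} δ_k(g_{j l̄})`. -/
def Lc (i j k : Fin n) (p : Pt n) : ℂ := ∑ l, gi L l i p * del L (gm L j l) k p

/-- The vertical Chern–Finsler connection coefficients `C^i_{jk} := g^{l̄ i} ∂g_{j l̄}/∂η^k`. -/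
def Cc (i j k : Fin n) (p : Pt n) : ℂ := ∑ l, gi L l i p * de (gm L j l) k p

/-- The spray coefficients `G^i := ½ N^i_j η^j`. -/
def Gs (i : Fin n) (p : Pt n) : ℂ := (1 / 2) * ∑ j, Nc L i j p * p.2 j

/-- The canonical horizontal derivation `δ̊_k := ∂/∂z^k − (∂G^j/∂η^k) ∂/∂η^j`. -/
def delc (f : Pt n → ℂ) (k : Fin n) (p : Pt n) : ℂ :=
  dz f k p - ∑ j, de (Gs L j) k p * de f j p

/-- `F := √L`. -/
def Fh (p : Pt n) : ℂ := (Real.sqrt ((L p).re) : ℂ)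

/-- `l^i := η^i / F`. -/
def lup (i : Fin n) (p : Pt n) : ℂ := p.2 i / Fh L p

/-- `l_i := g_{i j̄} η̄^j / F`. -/
def llow (i : Fin n) (p : Pt n) : ℂ :=
  (∑ j, gm L i j p * (starRingEnd ℂ) (p.2 j)) / Fh L p

/-- `√g` where `g := det(g_{i j̄})`. -/
def sg (p : Pt n) : ℂ := (Real.sqrt ((gmat L p).det.re) : ℂ)

/-- The metric is Kähler. -/
def IsKahler (D : Set (Pt n)) : Prop := ∀ p ∈ D, ∀ i j k, Lc L i j k p = Lc L i k j p

/-- The metric is weakly Kähler. -/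
def IsWeaklyKahler (D : Set (Pt n)) : Prop :=
  ∀ p ∈ D, ∀ k, (∑ i, ∑ j, ∑ l, gm L i l p * (Lc L i j k p - Lc L i k j p) *
    p.2 j * (starRingEnd ℂ) (p.2 l)) = 0

/-- The metric is purely Hermitian: `g_{i j̄}` does not depend on the fibre variable. -/
def IsPurelyHermitian (D : Set (Pt n)) : Prop :=
  ∀ p ∈ D, ∀ i j k, de (gm L i j) k p = 0 ∧ debar (gm L i j) k p = 0

/-- The metric is a complex Berwald metric: Kähler with `L^i_{jk}` independent of the
fibre variable. -/
def IsBerwald (D : Set (Pt n)) : Prop :=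
  IsKahler L D ∧ ∀ p ∈ D, ∀ i j k l, de (Lc L i j k) l p = 0 ∧ debar (Lc L i j k) l p = 0

/-- The metric is a complex Landsberg metric: the Berwald and Rund connections coincide. -/
def IsLandsberg (D : Set (Pt n)) : Prop :=
  ∀ p ∈ D, ∀ i j k, de (de (Gs L i) k) j p =
    (1 / 2) * ∑ l, gi L l i p * (delc L (gm L j l) k p + delc L (gm L k l) j p)

/-- `m^i` of the local complex Berwald frame: `m¹ = −l₂/√g`, `m² = l₁/√g`. -/
def mup (L : Pt 2 → ℂ) (i : Fin 2) (p : Pt 2) : ℂ :=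
  if i = 0 then -(llow L 1 p) / sg L p else llow L 0 p / sg L p

/-- `m_i := g_{i j̄} m̄^j`. -/
def mlow (L : Pt 2 → ℂ) (i : Fin 2) (p : Pt 2) : ℂ :=
  ∑ j, gm L i j p * (starRingEnd ℂ) (mup L j p)

/-- `A := m^j m^k l_h C^h_{kj}`. -/
def sA (L : Pt 2 → ℂ) (p : Pt 2) : ℂ :=
  ∑ j, ∑ k, ∑ h, mup L j p * mup L k p * llow L h p * Cc L h k j p

/-- `B := m_h m^k m^j C^h_{jk}`. -/
def sB (L : Pt 2 → ℂ) (p : Pt 2) : ℂ :=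
  ∑ j, ∑ k, ∑ h, mlow L h p * mup L k p * mup L j p * Cc L h j k p

/-- `J := l^j l^k l_i L^i_{jk}`. -/
def sJ (L : Pt 2 → ℂ) (p : Pt 2) : ℂ :=
  ∑ j, ∑ k, ∑ i, lup L j p * lup L k p * llow L i p * Lc L i j k p

/-- `U := m^j l^k l_i L^i_{jk}`. -/
def sU (L : Pt 2 → ℂ) (p : Pt 2) : ℂ :=
  ∑ j, ∑ k, ∑ i, mup L j p * lup L k p * llow L i p * Lc L i j k p

/-- `V := l^j m^k l_i L^i_{jk}`. -/
def sV (L : Pt 2 → ℂ) (p : Pt 2) : ℂ :=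
  ∑ j, ∑ k, ∑ i, lup L j p * mup L k p * llow L i p * Lc L i j k p

/-- `X := m^j m^k l_i L^i_{jk}`. -/
def sX (L : Pt 2 → ℂ) (p : Pt 2) : ℂ :=
  ∑ j, ∑ k, ∑ i, mup L j p * mup L k p * llow L i p * Lc L i j k p

/-- `O := l^j l^k m_i L^i_{jk}`. -/
def sO (L : Pt 2 → ℂ) (p : Pt 2) : ℂ :=
  ∑ j, ∑ k, ∑ i, lup L j p * lup L k p * mlow L i p * Lc L i j k p

/-- `Y := m^j l^k m_i L^i_{jk}`. -/
def sY (L : Pt 2 → ℂ) (p : Pt 2) : ℂ :=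
  ∑ j, ∑ k, ∑ i, mup L j p * lup L k p * mlow L i p * Lc L i j k p

/-- `E := l^j m^k m_i L^i_{jk}`. -/
def sE (L : Pt 2 → ℂ) (p : Pt 2) : ℂ :=
  ∑ j, ∑ k, ∑ i, lup L j p * mup L k p * mlow L i p * Lc L i j k p

/-- `H := m^j m^k m_i L^i_{jk}`. -/
def sH (L : Pt 2 → ℂ) (p : Pt 2) : ℂ :=
  ∑ j, ∑ k, ∑ i, mup L j p * mup L k p * mlow L i p * Lc L i j k p

/-- The vertical curvature invariant `I := −(∂B/∂η̄^s) m̄^s − B B̄/2`. -/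
def vI (L : Pt 2 → ℂ) (p : Pt 2) : ℂ :=
  -(∑ s, debar (sB L) s p * (starRingEnd ℂ) (mup L s p)) -
    sB L p * (starRingEnd ℂ) (sB L p) / 2

/-- The `v v̄`-Riemann type tensor `S_{r̄ j h̄ k} := −g_{i r̄} ∂C^i_{jk}/∂η̄^h`. -/
def Sv (L : Pt 2 → ℂ) (r j h k : Fin 2) (p : Pt 2) : ℂ :=
  -∑ i, gm L i r p * debar (Cc L i j k) h p

/-- The `h h̄`-Riemann type tensor
`R_{r̄ j h̄ k} := g_{i r̄} (−δ_h̄(L^i_{jk}) − δ_h̄(N^l_k) C^i_{jl})`. -/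
def Rh (L : Pt 2 → ℂ) (r j h k : Fin 2) (p : Pt 2) : ℂ :=
  ∑ i, gm L i r p *
    (-(delbar L (Lc L i j k) h p) - ∑ l, delbar L (Nc L l k) h p * Cc L i j l p)

/-- The horizontal curvature invariant `K := −(1/F) δ_k̄(J) η̄^k`. -/
def hK (L : Pt 2 → ℂ) (p : Pt 2) : ℂ :=
  -(1 / Fh L p) * ∑ k, delbar L (sJ L) k p * (starRingEnd ℂ) (p.2 k)

/-- The horizontal curvature invariant
`W := −δ_s̄(H) m̄^s − ½ H (V̄+H̄) − B F δ_s̄(E) m̄^s`. -/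
def hW (L : Pt 2 → ℂ) (p : Pt 2) : ℂ :=
  -(∑ s, delbar L (sH L) s p * (starRingEnd ℂ) (mup L s p)) -
    (1 / 2) * sH L p * ((starRingEnd ℂ) (sV L p) + (starRingEnd ℂ) (sH L p)) -
    sB L p * Fh L p * ∑ s, delbar L (sE L) s p * (starRingEnd ℂ) (mup L s p)

/-- The weak symmetry condition `R_{0̄ k 0̄ 0} = R_{0̄ 0 0̄ k}`, i.e.
`R_{r̄ k h̄ s} η̄^r η̄^h η^s = R_{r̄ s h̄ k} η̄^r η^s η̄^h`. -/
def WeakSym (L : Pt 2 → ℂ) (D : Set (Pt 2)) : Prop :=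
  ∀ p ∈ D, ∀ k,
    (∑ r, ∑ h, ∑ s, Rh L r k h s p * (starRingEnd ℂ) (p.2 r) *
      (starRingEnd ℂ) (p.2 h) * p.2 s) =
    ∑ r, ∑ s, ∑ h, Rh L r s h k p * (starRingEnd ℂ) (p.2 r) * p.2 s *
      (starRingEnd ℂ) (p.2 h)

section SmoothFunctions

variable {E : Type*} {D : Set E}

open Classical in
/-- Extension by zero of a function on a subset. -/
def zeroExt (D : Set E) (f : D → ℂ) (p : E) : ℂ := if h : p ∈ D then f ⟨p, h⟩ else 0

lemma zeroExt_of_mem (f : D → ℂ) {p : E} (h : p ∈ D) : zeroExt D f p = f ⟨p, h⟩ := dif_pos h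

variable [NormedAddCommGroup E] [NormedSpace ℝ E]

/-- The algebra of smooth complex functions on a subset. -/
def smoothAlg (D : Set E) : Subalgebra ℂ (D → ℂ) where
  carrier := {f | ContDiffOn ℝ (⊤ : ℕ∞) (zeroExt D f) D}
  mul_mem' {f g} hf hg := (ContDiffOn.mul hf hg).congr fun p hp => by
    simp [zeroExt_of_mem _ hp]
  add_mem' {f g} hf hg := (ContDiffOn.add hf hg).congr fun p hp => by
    simp [zeroExt_of_mem _ hp]
  algebraMap_mem' c := (contDiffOn_const (c := c)).congr fun p hp => by
    simp [zeroExt_of_mem _ hp]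

/-- `f` restricts to the element `r` of the algebra of smooth functions. -/
def Rep (f : E → ℂ) (r : smoothAlg D) : Prop := ∀ p (hp : p ∈ D), f p = r.1 ⟨p, hp⟩

lemma Rep.self (r : smoothAlg D) : Rep (zeroExt D r.1) r := fun _ hp => zeroExt_of_mem _ hp

lemma Rep.contDiffOn {f : E → ℂ} {r : smoothAlg D} (h : Rep f r) :
    ContDiffOn ℝ (⊤ : ℕ∞) f D :=
  ContDiffOn.congr r.2 fun p hp => by rw [h p hp, zeroExt_of_mem _ hp]

/-- The restriction of a function that is smooth on `D`. -/
def smoothRestrict (f : E → ℂ) (hf : ContDiffOn ℝ (⊤ : ℕ∞) f D) : smoothAlg D :=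
  ⟨fun p => f p, hf.congr fun p hp => by rw [zeroExt_of_mem _ hp]⟩

lemma rep_smoothRestrict {f : E → ℂ} (hf : ContDiffOn ℝ (⊤ : ℕ∞) f D) :
    Rep f (smoothRestrict f hf) := fun _ _ => rfl

lemma Rep.eq_iff {f g : E → ℂ} {r s : smoothAlg D} (hf : Rep f r) (hg : Rep g s) :
    r = s ↔ ∀ p ∈ D, f p = g p := by
  constructor
  · rintro rfl p hp
    rw [hf p hp, hg p hp]
  · intro h
    ext ⟨p, hp⟩
    rw [← hf p hp, ← hg p hp, h p hp]

lemma Rep.congr {f g : E → ℂ} {r : smoothAlg D} (hf : Rep f r) (h : ∀ p ∈ D, g p = f p) :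
    Rep g r := fun p hp => (h p hp).trans (hf p hp)

lemma Rep.add {f g : E → ℂ} {r s : smoothAlg D} (hf : Rep f r) (hg : Rep g s) :
    Rep (fun p => f p + g p) (r + s) := fun p hp => by simp [hf p hp, hg p hp]

lemma Rep.sub {f g : E → ℂ} {r s : smoothAlg D} (hf : Rep f r) (hg : Rep g s) :
    Rep (fun p => f p - g p) (r - s) := fun p hp => by simp [hf p hp, hg p hp]

lemma Rep.mul {f g : E → ℂ} {r s : smoothAlg D} (hf : Rep f r) (hg : Rep g s) :
    Rep (fun p => f p * g p) (r * s) := fun p hp => by simp [hf p hp, hg p hp]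

lemma Rep.neg {f : E → ℂ} {r : smoothAlg D} (hf : Rep f r) : Rep (fun p => -f p) (-r) :=
  fun p hp => by simp [hf p hp]

lemma Rep.zero : Rep (fun _ => 0) (0 : smoothAlg D) := fun _ _ => rfl

lemma Rep.one : Rep (fun _ => 1) (1 : smoothAlg D) := fun _ _ => rfl

lemma Rep.sum {ι : Type*} {s : Finset ι} {f : ι → E → ℂ} {r : ι → smoothAlg D}
    (h : ∀ i, Rep (f i) (r i)) : Rep (fun p => ∑ i ∈ s, f i p) (∑ i ∈ s, r i) := by
  classical
  induction s using Finset.induction_on with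
  | empty => simpa using Rep.zero
  | insert a s ha ih => simpa [Finset.sum_insert ha] using (h a).add ih

/-- Pointwise complex conjugation. -/
def smoothConj : smoothAlg D →+* smoothAlg D where
  toFun r := ⟨fun p => (starRingEnd ℂ) (r.1 p),
    (ContDiffOn.congr (Complex.conjCLE.contDiff.comp_contDiffOn r.2) fun p hp => by
      simp [zeroExt_of_mem _ hp])⟩
  map_one' := by ext; simp
  map_mul' _ _ := by ext; simp
  map_zero' := by ext; simp
  map_add' _ _ := by ext; simp

lemma Rep.conj {f : E → ℂ} {r : smoothAlg D} (hf : Rep f r) :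
    Rep (fun p => (starRingEnd ℂ) (f p)) (smoothConj r) := fun p hp => by
  simp [smoothConj, hf p hp]

lemma zeroExt_differentiableAt (hD : IsOpen D) (r : smoothAlg D) {p : E} (hp : p ∈ D) :
    DifferentiableAt ℝ (zeroExt D r.1) p :=
  (ContDiffOn.contDiffAt r.2 (hD.mem_nhds hp)).differentiableAt (by simp)

lemma Rep.fderiv_eq (hD : IsOpen D) {f g : E → ℂ} {r : smoothAlg D} (hf : Rep f r) (hg : Rep g r)
    {p : E} (hp : p ∈ D) : fderiv ℝ f p = fderiv ℝ g p :=
  Filter.EventuallyEq.fderiv_eq <| Filter.eventually_of_mem (hD.mem_nhds hp) fun q hq => by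
    rw [hf q hq, hg q hq]

/-- The directional derivative as a derivation of the algebra of smooth functions. -/
def dirDeriv (hD : IsOpen D) (u : E) : Derivation ℂ (smoothAlg D) (smoothAlg D) :=
  Derivation.mk'
    { toFun := fun r => smoothRestrict (fun p => fderiv ℝ (zeroExt D r.1) p u)
        ((ContDiffOn.fderiv_of_isOpen r.2 hD (by simp)).clm_apply contDiffOn_const)
      map_add' := by
        intro r s
        ext ⟨p, hp⟩
        simp only [smoothRestrict]
        rw [Rep.fderiv_eq hD (Rep.self (r + s)) ((Rep.self r).add (Rep.self s)) hp,
          fderiv_fun_add (zeroExt_differentiableAt hD r hp) (zeroExt_differentiableAt hD s hp)]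
        rfl
      map_smul' := by
        intro c r
        ext ⟨p, hp⟩
        have h : Rep (fun p => c • zeroExt D r.1 p) (c • r) := fun p hp => by
          simp [zeroExt_of_mem _ hp]
        simp only [smoothRestrict]
        rw [Rep.fderiv_eq hD (Rep.self (c • r)) h hp,
          fderiv_fun_const_smul (zeroExt_differentiableAt hD r hp)]
        rfl }
    (by
      intro r s
      ext ⟨p, hp⟩
      simp only [smoothRestrict, LinearMap.coe_mk, AddHom.coe_mk]
      rw [Rep.fderiv_eq hD (Rep.self (r * s)) ((Rep.self r).mul (Rep.self s)) hp,
        fderiv_fun_mul (zeroExt_differentiableAt hD r hp) (zeroExt_differentiableAt hD s hp)]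
      simp [zeroExt_of_mem _ hp])

lemma Rep.fderiv_apply (hD : IsOpen D) {f : E → ℂ} {r : smoothAlg D} (hf : Rep f r) (u : E) :
    Rep (fun p => fderiv ℝ f p u) (dirDeriv hD u r) := fun p hp => by
  change fderiv ℝ f p u = _
  rw [hf.fderiv_eq hD (Rep.self r) hp]
  rfl

lemma dirDeriv_comm (hD : IsOpen D) (u w : E) (r : smoothAlg D) :
    dirDeriv hD u (dirDeriv hD w r) = dirDeriv hD w (dirDeriv hD u r) := by
  rw [Rep.eq_iff (((Rep.self r).fderiv_apply hD w).fderiv_apply hD u)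
    (((Rep.self r).fderiv_apply hD u).fderiv_apply hD w)]
  intro p hp
  have hc : ContDiffAt ℝ (⊤ : ℕ∞) (zeroExt D r.1) p := ContDiffOn.contDiffAt r.2 (hD.mem_nhds hp)
  have hd : DifferentiableAt ℝ (fderiv ℝ (zeroExt D r.1)) p :=
    (hc.fderiv_right (m := 1) (WithTop.coe_le_coe.mpr le_top)).differentiableAt (by simp)
  rw [fderiv_clm_apply hd (differentiableAt_const _),
    fderiv_clm_apply hd (differentiableAt_const _)]
  have hs : IsSymmSndFDerivAt ℝ (zeroExt D r.1) p :=
    hc.isSymmSndFDerivAt (by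
      rw [minSmoothness_of_isRCLikeNormedField]
      exact WithTop.coe_le_coe.mpr (le_top : (2 : ℕ∞) ≤ ⊤))
  simpa using hs u w

lemma smoothConj_dirDeriv (hD : IsOpen D) (u : E) (r : smoothAlg D) :
    smoothConj (dirDeriv hD u r) = dirDeriv hD u (smoothConj r) := by
  rw [Rep.eq_iff ((Rep.self r).fderiv_apply hD u).conj ((Rep.self r).conj.fderiv_apply hD u)]
  intro p hp
  have h := (Complex.conjCLE.toContinuousLinearMap.hasFDerivAt.comp p
    (zeroExt_differentiableAt hD r hp).hasFDerivAt).fderiv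
  have h' : (fun p => (starRingEnd ℂ) (zeroExt D r.1 p)) =
    (Complex.conjCLE.toContinuousLinearMap : ℂ → ℂ) ∘ zeroExt D r.1 := by ext; simp
  rw [h', h]
  simp

/-- The Wirtinger derivation `½(∂_u - i ∂_w)`. -/
def wirt (hD : IsOpen D) (u w : E) : Derivation ℂ (smoothAlg D) (smoothAlg D) :=
  (1 / 2 : ℂ) • (dirDeriv hD u - Complex.I • dirDeriv hD w)

/-- The Wirtinger derivation `½(∂_u + i ∂_w)`. -/
def wirtBar (hD : IsOpen D) (u w : E) : Derivation ℂ (smoothAlg D) (smoothAlg D) :=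
  (1 / 2 : ℂ) • (dirDeriv hD u + Complex.I • dirDeriv hD w)

lemma wirtBar_eq (hD : IsOpen D) (u w : E) : wirtBar hD u w = wirt hD u (-w) := by
  have h : dirDeriv hD (-w) = -dirDeriv hD w := by
    ext r p
    simp [dirDeriv, smoothRestrict]
  refine Derivation.ext fun r => ?_
  simp only [wirt, wirtBar, h, Derivation.smul_apply, Derivation.add_apply, Derivation.sub_apply,
    Derivation.neg_apply, smul_neg, sub_neg_eq_add]

lemma wirt_comm (hD : IsOpen D) (u w u' w' : E) (r : smoothAlg D) :
    wirt hD u w (wirt hD u' w' r) = wirt hD u' w' (wirt hD u w r) := by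
  simp only [wirt, Derivation.smul_apply, Derivation.sub_apply, map_sub, Derivation.map_smul]
  rw [dirDeriv_comm hD u u', dirDeriv_comm hD u w', dirDeriv_comm hD w u', dirDeriv_comm hD w w']
  module

lemma smoothConj_smul (c : ℂ) (r : smoothAlg D) :
    smoothConj (c • r) = (starRingEnd ℂ) c • smoothConj r := by
  ext p
  simp [smoothConj]

lemma smoothConj_wirt (hD : IsOpen D) (u w : E) (r : smoothAlg D) :
    smoothConj (wirt hD u w r) = wirtBar hD u w (smoothConj r) := by
  simp [wirt, wirtBar, smoothConj_smul, ← smoothConj_dirDeriv hD, map_ofNat]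

lemma Rep.wirt (hD : IsOpen D) {f : E → ℂ} {r : smoothAlg D} (hf : Rep f r) (u w : E) :
    Rep (fun p => (1 / 2) * (fderiv ℝ f p u - Complex.I * fderiv ℝ f p w))
      (CFinsler.wirt hD u w r) := fun p hp => by
  have hu : fderiv ℝ f p u = _ := hf.fderiv_apply hD u p hp
  have hw : fderiv ℝ f p w = _ := hf.fderiv_apply hD w p hp
  simp [hu, hw, CFinsler.wirt]

lemma Rep.wirtBar (hD : IsOpen D) {f : E → ℂ} {r : smoothAlg D} (hf : Rep f r) (u w : E) :
    Rep (fun p => (1 / 2) * (fderiv ℝ f p u + Complex.I * fderiv ℝ f p w))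
      (CFinsler.wirtBar hD u w r) := fun p hp => by
  have hu : fderiv ℝ f p u = _ := hf.fderiv_apply hD u p hp
  have hw : fderiv ℝ f p w = _ := hf.fderiv_apply hD w p hp
  simp [hu, hw, CFinsler.wirtBar, mul_add]

end SmoothFunctions

/-- The algebraic data behind a two-dimensional complex Finsler metric: an algebra with conjugation
`cj`, commuting Wirtinger derivations `a = ∂/∂z`, `ab = ∂/∂z̄`, `v = ∂/∂η`, `vb = ∂/∂η̄`,
fibre coordinates `e`, a real function `L` with `η^k ∂L/∂η^k = L`, and the inverse `gi` of its
Levi form. -/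
structure FinslerAlgebra (R : Type*) [CommRing R] [Algebra ℂ R] where
  cj : R →+* R
  cj_cj : ∀ f, cj (cj f) = f
  a : Fin 2 → Derivation ℂ R R
  ab : Fin 2 → Derivation ℂ R R
  v : Fin 2 → Derivation ℂ R R
  vb : Fin 2 → Derivation ℂ R R
  cj_a : ∀ k f, cj (a k f) = ab k (cj f)
  cj_v : ∀ k f, cj (v k f) = vb k (cj f)
  a_a : ∀ j k f, a j (a k f) = a k (a j f)
  a_ab : ∀ j k f, a j (ab k f) = ab k (a j f)
  a_v : ∀ j k f, a j (v k f) = v k (a j f)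
  a_vb : ∀ j k f, a j (vb k f) = vb k (a j f)
  ab_v : ∀ j k f, ab j (v k f) = v k (ab j f)
  v_v : ∀ j k f, v j (v k f) = v k (v j f)
  v_vb : ∀ j k f, v j (vb k f) = vb k (v j f)
  e : Fin 2 → R
  a_e : ∀ j k, a j (e k) = 0
  ab_e : ∀ j k, ab j (e k) = 0
  v_e : ∀ j k, v j (e k) = if j = k then 1 else 0
  vb_e : ∀ j k, vb j (e k) = 0
  L : R
  cj_L : cj L = L
  euler : ∑ k, e k * v k L = L
  gi : Fin 2 → Fin 2 → R
  gi_mul : ∀ i j, ∑ m, gi m i * v j (vb m L) = if j = i then 1 else 0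
  mul_gi : ∀ m l, ∑ i, gi m i * v i (vb l L) = if m = l then 1 else 0

namespace FinslerAlgebra

variable {R : Type*} [CommRing R] [Algebra ℂ R] (D : FinslerAlgebra R)

/-- The conjugate fibre coordinates. -/
def eb (k : Fin 2) : R := D.cj (D.e k)

/-- The Chern–Finsler nonlinear connection. -/
def N (i k : Fin 2) : R := ∑ m, D.gi m i * D.a k (D.vb m D.L)

/-- The spray coefficients `N^i_k η^k`. -/
def T (i : Fin 2) : R := ∑ k, D.e k * D.N i k

/-- The horizontal derivation `δ_k`. -/
def del (k : Fin 2) : Derivation ℂ R R := D.a k - ∑ j, D.N j k • D.v j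

/-- The conjugate horizontal derivation. -/
def delb (k : Fin 2) : Derivation ℂ R R := D.ab k - ∑ j, D.cj (D.N j k) • D.vb j

/-- The complex spray `η^k δ_k`. -/
def X : Derivation ℂ R R := ∑ k, D.e k • D.del k

/-- The conjugate complex spray. -/
def Xb : Derivation ℂ R R := ∑ k, D.eb k • D.delb k

/-- The horizontal Chern–Finsler coefficients. -/
def Γ (i j k : Fin 2) : R := ∑ l, D.gi l i * D.del k (D.v j (D.vb l D.L))

/-- The vertical Chern–Finsler coefficients. -/
def C (i j k : Fin 2) : R := ∑ l, D.gi l i * D.v k (D.v j (D.vb l D.L))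

/-- The horizontal curvature tensor. -/
def Rm (r j h k : Fin 2) : R :=
  ∑ i, D.v i (D.vb r D.L) * (-(D.delb h (D.Γ i j k)) - ∑ l, D.delb h (D.N l k) * D.C i j l)

lemma del_apply (k : Fin 2) (f : R) : D.del k f = D.a k f - ∑ j, D.N j k * D.v j f := by
  simp [del, Fin.sum_univ_two]

lemma delb_apply (k : Fin 2) (f : R) :
    D.delb k f = D.ab k f - ∑ j, D.cj (D.N j k) * D.vb j f := by
  simp [delb, Fin.sum_univ_two]

lemma X_apply (f : R) : D.X f = ∑ k, D.e k * D.del k f := by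
  simp [X, Fin.sum_univ_two]

lemma Xb_apply (f : R) : D.Xb f = ∑ k, D.eb k * D.delb k f := by
  simp [Xb, Fin.sum_univ_two]

lemma X_apply' (f : R) : D.X f = ∑ k, D.e k * D.a k f - ∑ i, D.T i * D.v i f := by
  simp only [X_apply, del_apply, T, Fin.sum_univ_two]; ring

lemma cj_ab (k : Fin 2) (f : R) : D.cj (D.ab k f) = D.a k (D.cj f) := by
  rw [← D.cj_cj (D.a k (D.cj f)), D.cj_a, D.cj_cj]

lemma cj_vb (k : Fin 2) (f : R) : D.cj (D.vb k f) = D.v k (D.cj f) := by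
  rw [← D.cj_cj (D.v k (D.cj f)), D.cj_v, D.cj_cj]

lemma cj_del (k : Fin 2) (f : R) : D.cj (D.del k f) = D.delb k (D.cj f) := by
  simp [del_apply, delb_apply, D.cj_a, D.cj_v]

lemma cj_X (f : R) : D.cj (D.X f) = D.Xb (D.cj f) := by
  simp [X_apply, Xb_apply, D.cj_del, eb]

lemma cj_Xb (f : R) : D.cj (D.Xb f) = D.X (D.cj f) := by
  rw [← D.cj_cj (D.X (D.cj f)), D.cj_X, D.cj_cj]

lemma a_eb (j k : Fin 2) : D.a j (D.eb k) = 0 := by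
  rw [eb, ← D.cj_ab, D.ab_e, map_zero]

lemma v_eb (j k : Fin 2) : D.v j (D.eb k) = 0 := by
  rw [eb, ← D.cj_vb, D.vb_e, map_zero]

lemma del_e (j k : Fin 2) : D.del j (D.e k) = -D.N k j := by
  fin_cases k <;> simp [del_apply, D.a_e, D.v_e]

lemma del_eb (j k : Fin 2) : D.del j (D.eb k) = 0 := by
  simp [del_apply, D.a_eb, D.v_eb]

lemma delb_e (j k : Fin 2) : D.delb j (D.e k) = 0 := by
  simp [delb_apply, D.ab_e, D.vb_e]

lemma X_eb (k : Fin 2) : D.X (D.eb k) = 0 := by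
  simp [X_apply, D.del_eb]

lemma Xb_e (k : Fin 2) : D.Xb (D.e k) = 0 := by
  simp [Xb_apply, D.delb_e]

lemma euler_bar : ∑ k, D.eb k * D.vb k D.L = D.L := by
  have h := congrArg D.cj D.euler
  simpa [D.cj_v, D.cj_L, eb] using h

/-- `η^i g_{i j̄} = L_j̄`. -/
lemma e_mul_g (j : Fin 2) : ∑ i, D.e i * D.v i (D.vb j D.L) = D.vb j D.L := by
  have h := congrArg (D.vb j) D.euler
  simp [D.vb_e, ← D.v_vb] at h
  simpa using h

/-- `g_{i j̄} η̄^j = L_i`. -/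
lemma g_mul_eb (i : Fin 2) : ∑ j, D.v i (D.vb j D.L) * D.eb j = D.v i D.L := by
  have h := congrArg D.cj (D.e_mul_g i)
  simp only [map_sum, map_mul, D.cj_v, D.cj_vb, D.cj_L, ← D.v_vb] at h
  simpa [mul_comm, eb] using h

/-- `η^i L_{ij} = 0`. -/
lemma e_mul_hess (j : Fin 2) : ∑ i, D.e i * D.v i (D.v j D.L) = 0 := by
  have h := congrArg (D.v j) D.euler
  simp only [map_add, Derivation.leibniz, smul_eq_mul, D.v_e, D.v_v j, Fin.sum_univ_two] at h ⊢
  fin_cases j <;> simp at h ⊢ <;> linear_combination h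

/-- `g_{i m̄} N^i_k = ∂L_m̄/∂z^k`. -/
lemma g_mul_N (m k : Fin 2) : ∑ i, D.v i (D.vb m D.L) * D.N i k = D.a k (D.vb m D.L) := by
  have h0 := D.mul_gi 0 m
  have h1 := D.mul_gi 1 m
  simp only [N, Fin.sum_univ_two] at h0 h1 ⊢
  fin_cases m <;> simp at h0 h1 ⊢
  · linear_combination D.a k (D.vb 0 D.L) * h0 + D.a k (D.vb 1 D.L) * h1
  · linear_combination D.a k (D.vb 0 D.L) * h0 + D.a k (D.vb 1 D.L) * h1

lemma del_vb_L (k m : Fin 2) : D.del k (D.vb m D.L) = 0 := by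
  have h := D.g_mul_N m k
  simp only [del_apply, Fin.sum_univ_two] at h ⊢
  linear_combination -h

lemma delb_v_L (k m : Fin 2) : D.delb k (D.v m D.L) = 0 := by
  have h := congrArg D.cj (D.del_vb_L k m)
  simpa [D.cj_del, D.cj_vb, D.cj_L] using h

lemma del_L (k : Fin 2) : D.del k D.L = 0 := by
  have h := congrArg (D.del k) D.euler_bar
  simp [D.del_eb, D.del_vb_L] at h
  exact h.symm

lemma delb_L (k : Fin 2) : D.delb k D.L = 0 := by
  have h := congrArg D.cj (D.del_L k)
  simpa [D.cj_del, D.cj_L] using h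

lemma Xb_v_L (m : Fin 2) : D.Xb (D.v m D.L) = 0 := by
  simp [Xb_apply, D.delb_v_L]

lemma Xb_L : D.Xb D.L = 0 := by
  simp [Xb_apply, D.delb_L]

/-- `N^j_k L_j = ∂L/∂z^k`. -/
lemma N_mul_v_L (k : Fin 2) : ∑ j, D.N j k * D.v j D.L = D.a k D.L := by
  have h := D.del_L k
  rw [del_apply] at h
  exact (sub_eq_zero.mp h).symm

lemma e_mul_del_v_L (k : Fin 2) : ∑ j, D.e j * D.del k (D.v j D.L) = D.a k D.L := by
  have h := congrArg (D.del k) D.euler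
  have h' := D.N_mul_v_L k
  simp [D.del_e, D.del_L, Fin.sum_univ_two] at h h' ⊢
  linear_combination h + h'

/-- `L_i T^i = η^k ∂L/∂z^k`. -/
lemma v_L_mul_T : ∑ i, D.v i D.L * D.T i = ∑ k, D.e k * D.a k D.L := by
  have h0 := D.N_mul_v_L 0
  have h1 := D.N_mul_v_L 1
  simp only [T, Fin.sum_univ_two] at h0 h1 ⊢
  linear_combination D.e 0 * h0 + D.e 1 * h1

/-- `L_i ∂T^i/∂η̄^k = 0`. -/
lemma v_L_mul_vb_T (k : Fin 2) : ∑ i, D.v i D.L * D.vb k (D.T i) = 0 := by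
  have h := congrArg (D.vb k) D.v_L_mul_T
  have h0 := D.g_mul_N k 0
  have h1 := D.g_mul_N k 1
  simp only [Fin.sum_univ_two, Derivation.leibniz, map_add, smul_eq_mul, D.vb_e, ← D.v_vb,
    ← D.a_vb] at h h0 h1 ⊢
  have t0 : D.T 0 = D.e 0 * D.N 0 0 + D.e 1 * D.N 0 1 := by simp [T, Fin.sum_univ_two]
  have t1 : D.T 1 = D.e 0 * D.N 1 0 + D.e 1 * D.N 1 1 := by simp [T, Fin.sum_univ_two]
  linear_combination h - D.e 0 * h0 - D.e 1 * h1 - D.v 0 (D.vb k D.L) * t0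
    - D.v 1 (D.vb k D.L) * t1

/-- `[X̄, X] = -X̄(T^i) ∂/∂η^i + X(T̄^i) ∂/∂η̄^i`. -/
lemma Xb_X (f : R) : D.Xb (D.X f) = D.X (D.Xb f) - ∑ i, D.Xb (D.T i) * D.v i f
    + ∑ i, D.X (D.cj (D.T i)) * D.vb i f := by
  have hXb : ∀ f, D.Xb f = ∑ k, D.eb k * D.ab k f - ∑ i, D.cj (D.T i) * D.vb i f := by
    intro f
    have h := congrArg D.cj (D.X_apply' (D.cj f))
    rw [D.cj_X, D.cj_cj] at h
    simpa [D.cj_a, D.cj_v, D.cj_cj, eb] using h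
  rw [D.X_apply' f, hXb f]
  simp only [map_sub, map_add, Derivation.leibniz, smul_eq_mul, D.Xb_e, D.X_eb,
    Fin.sum_univ_two, mul_zero, add_zero]
  simp only [hXb (D.a _ _), hXb (D.v _ _), D.X_apply' (D.ab _ _), D.X_apply' (D.vb _ _),
    Fin.sum_univ_two, D.a_ab, D.a_vb, D.ab_v, D.v_vb]
  ring

/-- The horizontal derivations commute. -/
lemma del_del (j k : Fin 2) (f : R) : D.del j (D.del k f) = D.del k (D.del j f) := by
  have key : ∀ f, D.del j (D.del k f) - D.del k (D.del j f) =
      -∑ i, (D.del j (D.N i k) - D.del k (D.N i j)) * D.v i f := by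
    intro f
    rw [D.del_apply k f, D.del_apply j f]
    simp only [map_sub, map_add, Derivation.leibniz, smul_eq_mul, Fin.sum_univ_two]
    simp only [D.del_apply _ (D.a _ _), D.del_apply _ (D.v _ _), Fin.sum_univ_two,
      D.a_a j k, D.a_v, D.v_v 1 0]
    ring
  have h0 := key (D.vb 0 D.L)
  have h1 := key (D.vb 1 D.L)
  simp only [D.del_vb_L, map_zero, sub_zero] at h0 h1
  have hN : ∀ i, D.del j (D.N i k) - D.del k (D.N i j) = 0 := by
    intro i
    have g0 := D.gi_mul i 0
    have g1 := D.gi_mul i 1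
    simp only [Fin.sum_univ_two] at h0 h1 g0 g1
    fin_cases i <;> simp at g0 g1 ⊢
    · linear_combination D.gi 0 0 * h0 + D.gi 1 0 * h1 -
        (D.del j (D.N 0 k) - D.del k (D.N 0 j)) * g0 -
        (D.del j (D.N 1 k) - D.del k (D.N 1 j)) * g1
    · linear_combination D.gi 0 1 * h0 + D.gi 1 1 * h1 -
        (D.del j (D.N 0 k) - D.del k (D.N 0 j)) * g0 -
        (D.del j (D.N 1 k) - D.del k (D.N 1 j)) * g1
  have := key f
  simp only [hN] at this
  simpa [sub_eq_zero] using this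

/-- `X̄(∂L/∂z^k) = δ_k(η̄^h ∂L/∂z̄^h)`. -/
lemma Xb_a_L (k : Fin 2) : D.Xb (D.a k D.L) = D.del k (∑ h, D.eb h * D.ab h D.L) := by
  have h0 := D.g_mul_N 0 k
  have h1 := D.g_mul_N 1 k
  have c : ∀ l h, ∑ m, D.v l (D.vb m D.L) * D.cj (D.N m h) = D.v l (D.ab h D.L) := by
    intro l h
    have := congrArg D.cj (D.g_mul_N l h)
    simp only [map_sum, map_mul, D.cj_a, D.cj_v, D.cj_vb, D.cj_L, ← D.v_vb] at this
    rw [this, D.ab_v]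
  have c00 := c 0 0
  have c01 := c 0 1
  have c10 := c 1 0
  have c11 := c 1 1
  simp only [Xb_apply, delb_apply, del_apply, Fin.sum_univ_two, map_add, Derivation.leibniz,
    smul_eq_mul, D.a_eb, D.v_eb, ← D.a_ab, ← D.a_vb] at *
  rw [← h0, ← h1]
  linear_combination -(D.N 0 k * D.eb 0) * c00 - (D.N 0 k * D.eb 1) * c01
    - (D.N 1 k * D.eb 0) * c10 - (D.N 1 k * D.eb 1) * c11

/-- `η^j Γ^i_{jk} = N^i_k`. -/
lemma e_mul_Γ (i k : Fin 2) : ∑ j, D.e j * D.Γ i j k = D.N i k := by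
  have h : ∀ l, ∑ j, D.e j * D.del k (D.v j (D.vb l D.L)) = D.a k (D.vb l D.L) := by
    intro l
    have h1 := congrArg (D.del k) (D.e_mul_g l)
    have h2 := D.g_mul_N l k
    simp only [map_add, Derivation.leibniz, smul_eq_mul, D.del_e, D.del_vb_L,
      Fin.sum_univ_two] at h1 h2 ⊢
    linear_combination h1 + h2
  have h0 := h 0
  have h1 := h 1
  simp only [Γ, N, Fin.sum_univ_two] at h0 h1 ⊢
  linear_combination D.gi 0 i * h0 + D.gi 1 i * h1

lemma g_mul_Γ (l j k : Fin 2) :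
    ∑ i, D.v i (D.vb l D.L) * D.Γ i j k = D.del k (D.v j (D.vb l D.L)) := by
  have h0 := D.mul_gi 0 l
  have h1 := D.mul_gi 1 l
  simp only [Γ, Fin.sum_univ_two] at h0 h1 ⊢
  fin_cases l <;> simp at h0 h1 ⊢
  · linear_combination D.del k (D.v j (D.vb 0 D.L)) * h0 + D.del k (D.v j (D.vb 1 D.L)) * h1
  · linear_combination D.del k (D.v j (D.vb 0 D.L)) * h0 + D.del k (D.v j (D.vb 1 D.L)) * h1

lemma g_mul_C (l j k : Fin 2) :
    ∑ i, D.v i (D.vb l D.L) * D.C i j k = D.v k (D.v j (D.vb l D.L)) := by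
  have h0 := D.mul_gi 0 l
  have h1 := D.mul_gi 1 l
  simp only [C, Fin.sum_univ_two] at h0 h1 ⊢
  fin_cases l <;> simp at h0 h1 ⊢
  · linear_combination D.v k (D.v j (D.vb 0 D.L)) * h0 + D.v k (D.v j (D.vb 1 D.L)) * h1
  · linear_combination D.v k (D.v j (D.vb 0 D.L)) * h0 + D.v k (D.v j (D.vb 1 D.L)) * h1

lemma v_L_mul_Γ (j k : Fin 2) : ∑ i, D.v i D.L * D.Γ i j k = D.del k (D.v j D.L) := by
  have h0 := D.g_mul_Γ 0 j k
  have h1 := D.g_mul_Γ 1 j k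
  simp only [← D.g_mul_eb, map_add, Derivation.leibniz, D.del_eb, smul_eq_mul,
    Fin.sum_univ_two] at h0 h1 ⊢
  linear_combination D.eb 0 * h0 + D.eb 1 * h1

lemma v_L_mul_C (j k : Fin 2) : ∑ i, D.v i D.L * D.C i j k = D.v k (D.v j D.L) := by
  have h0 := D.g_mul_C 0 j k
  have h1 := D.g_mul_C 1 j k
  simp only [← D.g_mul_eb, map_add, Derivation.leibniz, D.v_eb, smul_eq_mul,
    Fin.sum_univ_two] at h0 h1 ⊢
  linear_combination D.eb 0 * h0 + D.eb 1 * h1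

/-- The weakly Kähler condition says `X(L_k) = ∂L/∂z^k`. -/
lemma X_v_L (h : ∀ k, ∑ i, ∑ j, ∑ l, D.v i (D.vb l D.L) * (D.Γ i j k - D.Γ i k j) *
    D.e j * D.eb l = 0) (k : Fin 2) : D.X (D.v k D.L) = D.a k D.L := by
  have hk := h k
  have e0 := D.v_L_mul_Γ 0 k
  have e1 := D.v_L_mul_Γ 1 k
  have f0 := D.v_L_mul_Γ k 0
  have f1 := D.v_L_mul_Γ k 1
  have g := D.e_mul_del_v_L k
  have l0 := D.g_mul_eb 0
  have l1 := D.g_mul_eb 1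
  rw [X_apply]
  simp only [Fin.sum_univ_two] at *
  rw [← e0, ← e1, ← l0, ← l1] at g
  rw [← f0, ← f1, ← l0, ← l1]
  linear_combination g - hk

/-- `R_{0̄ k 0̄ 0} = -X̄(X(L_k)) - X̄(T^l) L_{kl}`. -/
lemma Rm_contract (k : Fin 2) :
    ∑ r, ∑ h, ∑ s, D.Rm r k h s * D.eb r * D.eb h * D.e s =
      -D.Xb (D.X (D.v k D.L)) - ∑ l, D.Xb (D.T l) * D.v l (D.v k D.L) := by
  have hX : D.X (D.v k D.L) = ∑ s, D.e s * ∑ i, D.v i D.L * D.Γ i k s := by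
    simp only [X_apply, v_L_mul_Γ]
  have hT : ∀ l, D.Xb (D.T l) = ∑ s, D.e s * D.Xb (D.N l s) := by
    intro l
    simp [T, D.Xb_e]
  simp only [hX, hT, Fin.sum_univ_two, map_add, Derivation.leibniz, smul_eq_mul, D.Xb_e,
    D.Xb_v_L]
  have c0 := D.v_L_mul_C k 0
  have c1 := D.v_L_mul_C k 1
  have l0 := D.g_mul_eb 0
  have l1 := D.g_mul_eb 1
  simp only [Fin.sum_univ_two] at c0 c1 l0 l1
  simp only [← c0, ← c1, ← l0, ← l1, Rm, Xb_apply, Fin.sum_univ_two]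
  ring

/-- `R_{0̄ 0 0̄ k} = -X̄(∂L/∂z^k)`. -/
lemma Rm_contract' (k : Fin 2) :
    ∑ r, ∑ s, ∑ h, D.Rm r s h k * D.eb r * D.e s * D.eb h = -D.Xb (D.a k D.L) := by
  have hN : ∀ i, D.Xb (D.N i k) = ∑ j, D.e j * D.Xb (D.Γ i j k) := by
    intro i
    rw [← D.e_mul_Γ i k]
    simp [D.Xb_e]
  have hC : ∀ l, ∑ s, D.e s * ∑ i, D.v i D.L * D.C i s l = 0 := by
    intro l
    simp only [D.v_L_mul_C, D.v_v l]
    exact D.e_mul_hess l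
  have hC0 := hC 0
  have hC1 := hC 1
  have l0 := D.g_mul_eb 0
  have l1 := D.g_mul_eb 1
  rw [← D.N_mul_v_L k]
  simp only [Fin.sum_univ_two, map_add, Derivation.leibniz, smul_eq_mul, D.Xb_v_L, hN]
    at hC0 hC1 l0 l1 ⊢
  simp only [← l0, ← l1, Rm, Xb_apply, Fin.sum_univ_two] at hC0 hC1 ⊢
  linear_combination -(D.eb 0 * D.delb 0 (D.N 0 k) + D.eb 1 * D.delb 1 (D.N 0 k)) * hC0
    - (D.eb 0 * D.delb 0 (D.N 1 k) + D.eb 1 * D.delb 1 (D.N 1 k)) * hC1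

/-- Weak symmetry for a weakly Kähler metric says `X̄(T^l) L_{kl} = 0`. -/
lemma Xb_T_mul_hess (hX : ∀ k, D.X (D.v k D.L) = D.a k D.L)
    (h : ∀ k, ∑ r, ∑ h, ∑ s, D.Rm r k h s * D.eb r * D.eb h * D.e s =
      ∑ r, ∑ s, ∑ h, D.Rm r s h k * D.eb r * D.e s * D.eb h) (k : Fin 2) :
    ∑ l, D.Xb (D.T l) * D.v l (D.v k D.L) = 0 := by
  have hk := h k
  rw [Rm_contract, Rm_contract', hX] at hk
  linear_combination -hk

section Constancy

variable {D}
variable {K Li : R} (hX : ∀ k, D.X (D.v k D.L) = D.a k D.L)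
  (hS : ∀ k, ∑ l, D.Xb (D.T l) * D.v l (D.v k D.L) = 0)
  (hH : ∀ w, (∀ j k, D.v j (D.v k D.L) * w = 0) → w = 0)
  (hLi : D.L * Li = 1) (hK : K = -Li ^ 2 * ∑ i, D.v i D.L * D.Xb (D.T i))
include hS hH hLi hK

/-- `X̄(T^l) = -K L η^l`. -/
lemma Xb_T (l : Fin 2) : D.Xb (D.T l) = -K * D.L * D.e l := by
  have hw : D.Xb (D.T 0) * D.e 1 - D.Xb (D.T 1) * D.e 0 = 0 := by
    apply hH
    intro j k
    have h1 := hS k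
    have h2 := D.e_mul_hess k
    simp only [Fin.sum_univ_two] at h1 h2
    fin_cases j <;> simp
    · linear_combination D.e 1 * h1 - D.Xb (D.T 1) * h2
    · linear_combination -D.e 0 * h1 + D.Xb (D.T 0) * h2
  have he := D.euler
  simp only [Fin.sum_univ_two] at he hK
  have key : D.L * D.Xb (D.T l) =
      (D.v 0 D.L * D.Xb (D.T 0) + D.v 1 D.L * D.Xb (D.T 1)) * D.e l := by
    fin_cases l <;> simp
    · linear_combination D.v 1 D.L * hw - D.Xb (D.T 0) * he
    · linear_combination -D.v 0 D.L * hw - D.Xb (D.T 1) * he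
  rw [hK]
  linear_combination Li * key - (D.Xb (D.T l) + Li * (D.v 0 D.L * D.Xb (D.T 0) +
    D.v 1 D.L * D.Xb (D.T 1)) * D.e l) * hLi

include hX

/-- `X̄(∂L/∂z^k) = -K̄ L L_k`. -/
lemma Xb_a_L_eq_conj (k : Fin 2) : D.Xb (D.a k D.L) = -D.cj K * D.L * D.v k D.L := by
  have h := D.Xb_X (D.v k D.L)
  have hc : ∀ l, D.X (D.cj (D.T l)) = -D.cj K * D.L * D.eb l := by
    intro l
    rw [← D.cj_Xb, Xb_T hS hH hLi hK l]
    simp [D.cj_L, eb]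
  rw [hX, hS, D.Xb_v_L] at h
  simp only [hc, map_zero, ← D.v_vb] at h
  have l := D.g_mul_eb k
  simp only [Fin.sum_univ_two] at h l
  linear_combination h - D.cj K * D.L * l

lemma cj_K : D.cj K = K := by
  have h := congrArg D.Xb D.v_L_mul_T
  have he := D.euler
  simp only [Fin.sum_univ_two, map_add, Derivation.leibniz, smul_eq_mul, D.Xb_v_L, D.Xb_e,
    Xb_T hS hH hLi hK, Xb_a_L_eq_conj hX hS hH hLi hK] at h he
  linear_combination (D.cj K - K) * (-(D.L * Li + 1) * hLi) + Li ^ 2 * h +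
    (D.cj K - K) * D.L * -Li ^ 2 * he

lemma Xb_a_L_eq (k : Fin 2) : D.Xb (D.a k D.L) = -K * D.L * D.v k D.L := by
  rw [Xb_a_L_eq_conj hX hS hH hLi hK, cj_K hX hS hH hLi hK]

/-- `K` is constant along the fibres. -/
lemma v_K (m : Fin 2) : D.v m K = 0 := by
  have hXb : ∀ f, D.v m (D.Xb f) = D.Xb (D.v m f) - ∑ i, D.v m (D.cj (D.T i)) * D.vb i f := by
    intro f
    have hXb : ∀ f, D.Xb f = ∑ k, D.eb k * D.ab k f - ∑ i, D.cj (D.T i) * D.vb i f := by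
      intro f
      have h := congrArg D.cj (D.X_apply' (D.cj f))
      rw [D.cj_X, D.cj_cj] at h
      simpa [D.cj_a, D.cj_v, D.cj_cj, eb] using h
    rw [hXb f, hXb (D.v m f)]
    simp only [map_sub, map_add, Derivation.leibniz, smul_eq_mul, Fin.sum_univ_two, D.v_eb,
      D.ab_v, D.v_vb]
    ring
  have hT : ∑ l, D.v l D.L * D.v m (D.T l) = 2 * D.a m D.L := by
    have h := congrArg (D.v m) D.v_L_mul_T
    have h2 := hX m
    rw [X_apply'] at h2
    simp only [Fin.sum_univ_two, map_add, Derivation.leibniz, smul_eq_mul, D.v_e, D.a_v] at h h2 ⊢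
    rw [D.v_v 0 m, D.v_v 1 m] at h2
    fin_cases m <;> simp at h h2 ⊢ <;> linear_combination h + h2
  have hT' := congrArg D.Xb hT
  have t0 := D.v_L_mul_vb_T 0
  have t1 := D.v_L_mul_vb_T 1
  have s0 := hXb (D.T 0)
  have s1 := hXb (D.T 1)
  have he := D.euler
  have h2 : D.Xb (2 : R) = 0 := by simpa using D.Xb.map_natCast 2
  have hv : D.v 0 D.L * D.v m (D.e 0) + D.v 1 D.L * D.v m (D.e 1) = D.v m D.L := by
    fin_cases m <;> simp [D.v_e]
  rw [Xb_T hS hH hLi hK] at s0 s1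
  simp only [Fin.sum_univ_two, map_add, Derivation.leibniz, smul_eq_mul, D.Xb_v_L, h2, map_neg,
    Xb_a_L_eq hX hS hH hLi hK] at *
  have : D.L ^ 2 * D.v m K = 0 := by
    linear_combination -hT' - D.v 0 D.L * s0 - D.v 1 D.L * s1 + D.v m (D.cj (D.T 0)) * t0
      + D.v m (D.cj (D.T 1)) * t1 - (D.v m K * D.L + K * D.v m D.L) * he - K * D.L * hv
  linear_combination Li ^ 2 * this - D.v m K * (D.L * Li + 1) * hLi

lemma vb_K (m : Fin 2) : D.vb m K = 0 := by
  have h := congrArg D.cj (v_K hX hS hH hLi hK m)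
  rwa [D.cj_v, cj_K hX hS hH hLi hK, map_zero] at h

/-- `K` is constant along the base. -/
lemma a_K (k : Fin 2) : D.a k K = 0 := by
  have hd : ∀ k, D.del k K = D.a k K := by
    intro k
    simp [del_apply, v_K hX hS hH hLi hK]
  have hQ : ∀ k, D.del k (∑ h, D.eb h * D.ab h D.L) = -K * D.L * D.v k D.L := by
    intro k
    rw [← D.Xb_a_L, Xb_a_L_eq hX hS hH hLi hK]
  have h1 : ∀ k, (∑ j, D.e j * D.a j K) * D.v k D.L = D.a k K * D.L := by
    intro k
    have c0 := D.del_del 0 k (∑ h, D.eb h * D.ab h D.L)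
    have c1 := D.del_del 1 k (∑ h, D.eb h * D.ab h D.L)
    have hx := hX k
    have hx' := D.e_mul_del_v_L k
    have he := D.euler
    rw [X_apply] at hx
    rw [hQ, hQ] at c0 c1
    simp only [map_neg, Derivation.leibniz, smul_eq_mul, D.del_L, hd, Fin.sum_univ_two] at *
    linear_combination -Li * (D.e 0 * c0 + D.e 1 * c1) - K * D.L * Li * hx + K * D.L * Li * hx'
      + D.a k K * D.L * Li * he
      - ((D.e 0 * D.a 0 K + D.e 1 * D.a 1 K) * D.v k D.L - D.a k K * D.L) * hLi
  have h2 : ∀ k m, (∑ j, D.e j * D.a j K) * D.v k (D.vb m D.L) = D.a k K * D.vb m D.L := by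
    intro k m
    have h := congrArg (D.vb m) (h1 k)
    simpa [D.vb_e, ← D.a_vb, ← D.v_vb, vb_K hX hS hH hLi hK] using h
  have h3 : ∀ i k, (∑ j, D.e j * D.a j K) * (if k = i then 1 else 0) = D.a k K * D.e i := by
    intro i k
    have e0 := D.e_mul_g 0
    have e1 := D.e_mul_g 1
    have g0 := D.gi_mul i 0
    have g1 := D.gi_mul i 1
    rw [← D.gi_mul i k]
    have m0 := h2 k 0
    have m1 := h2 k 1
    simp only [Fin.sum_univ_two] at *
    have key : D.gi 0 i * D.vb 0 D.L + D.gi 1 i * D.vb 1 D.L = D.e i := by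
      rw [← e0, ← e1]
      fin_cases i <;> simp at g0 g1 ⊢ <;> linear_combination D.e 0 * g0 + D.e 1 * g1
    linear_combination D.gi 0 i * m0 + D.gi 1 i * m1 + D.a k K * key
  have h4 : ∑ j, D.e j * D.a j K = 0 := by
    have p := h3 0 0
    have q := h3 1 1
    simp only [Fin.sum_univ_two] at *
    simp at p q
    linear_combination p + q
  have h5 := h1 k
  rw [h4] at h5
  linear_combination -Li * h5 - D.a k K * hLi

lemma ab_K (k : Fin 2) : D.ab k K = 0 := by
  have h := congrArg D.cj (a_K hX hS hH hLi hK k)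
  rwa [D.cj_a, cj_K hX hS hH hLi hK, map_zero] at h

end Constancy

/-- The curvature invariant `-(1/F) η̄^k δ_k̄(J)`, with `J = l^j l^k l_i Γ^i_{jk}`. -/
lemma curvature_eq {F Fi : R} (hF : F * F = D.L) (hFi : F * Fi = 1) :
    -Fi * ∑ k, D.delb k (∑ j, ∑ k, ∑ i, D.e j * Fi * (D.e k * Fi) *
      ((∑ l, D.v i (D.vb l D.L) * D.eb l) * Fi) * D.Γ i j k) * D.eb k =
      -(Fi ^ 2) ^ 2 * ∑ i, D.v i D.L * D.Xb (D.T i) := by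
  have hXF : D.Xb F = 0 := by
    have h := congrArg D.Xb hF
    rw [D.Xb_L, Derivation.leibniz, smul_eq_mul, ← two_smul ℂ] at h
    have h' : F * D.Xb F = 0 := (smul_eq_zero_iff_right (two_ne_zero (α := ℂ))).mp h
    linear_combination Fi * h' - D.Xb F * hFi
  have hXFi : D.Xb Fi = 0 := by
    have h := congrArg D.Xb hFi
    rw [Derivation.leibniz, hXF, Derivation.map_one_eq_zero, smul_zero, add_zero, smul_eq_mul] at h
    linear_combination Fi * h - D.Xb Fi * hFi
  have hJ : ∑ j, ∑ k, ∑ i, D.e j * Fi * (D.e k * Fi) *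
      ((∑ l, D.v i (D.vb l D.L) * D.eb l) * Fi) * D.Γ i j k =
      Fi * (Fi * (Fi * ∑ i, D.v i D.L * D.T i)) := by
    simp only [D.g_mul_eb, T, ← D.e_mul_Γ, Fin.sum_univ_two]
    ring
  rw [hJ]
  have : ∀ f, ∑ k, D.delb k f * D.eb k = D.Xb f := by
    intro f
    simp only [Xb_apply, mul_comm]
  rw [this]
  simp only [Derivation.leibniz, smul_eq_mul, hXFi, D.Xb_v_L, Fin.sum_univ_two, map_add]
  ring

end FinslerAlgebra

section Metric

variable {D : Set (Pt 2)} {L : Pt 2 → ℂ}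

/-- The derivation `∂/∂z^k` of the algebra of smooth functions. -/
def dzD (hD : IsOpen D) (k : Fin 2) : Derivation ℂ (smoothAlg D) (smoothAlg D) :=
  wirt hD ((Pi.single k 1 : Fin 2 → ℂ), 0) ((Pi.single k Complex.I : Fin 2 → ℂ), 0)

/-- The derivation `∂/∂z̄^k` of the algebra of smooth functions. -/
def dzbarD (hD : IsOpen D) (k : Fin 2) : Derivation ℂ (smoothAlg D) (smoothAlg D) :=
  wirtBar hD ((Pi.single k 1 : Fin 2 → ℂ), 0) ((Pi.single k Complex.I : Fin 2 → ℂ), 0)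

/-- The derivation `∂/∂η^k` of the algebra of smooth functions. -/
def deD (hD : IsOpen D) (k : Fin 2) : Derivation ℂ (smoothAlg D) (smoothAlg D) :=
  wirt hD (0, (Pi.single k 1 : Fin 2 → ℂ)) (0, (Pi.single k Complex.I : Fin 2 → ℂ))

/-- The derivation `∂/∂η̄^k` of the algebra of smooth functions. -/
def debarD (hD : IsOpen D) (k : Fin 2) : Derivation ℂ (smoothAlg D) (smoothAlg D) :=
  wirtBar hD (0, (Pi.single k 1 : Fin 2 → ℂ)) (0, (Pi.single k Complex.I : Fin 2 → ℂ))

lemma Rep.dz (hD : IsOpen D) {f : Pt 2 → ℂ} {r : smoothAlg D} (hf : Rep f r) (k : Fin 2) :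
    Rep (dz f k) (dzD hD k r) := hf.wirt hD _ _

lemma Rep.dzbar (hD : IsOpen D) {f : Pt 2 → ℂ} {r : smoothAlg D} (hf : Rep f r) (k : Fin 2) :
    Rep (dzbar f k) (dzbarD hD k r) := hf.wirtBar hD _ _

lemma Rep.de (hD : IsOpen D) {f : Pt 2 → ℂ} {r : smoothAlg D} (hf : Rep f r) (k : Fin 2) :
    Rep (de f k) (deD hD k r) := hf.wirt hD _ _

lemma Rep.debar (hD : IsOpen D) {f : Pt 2 → ℂ} {r : smoothAlg D} (hf : Rep f r) (k : Fin 2) :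
    Rep (debar f k) (debarD hD k r) := hf.wirtBar hD _ _

lemma contDiffOn_fibre (k : Fin 2) : ContDiffOn ℝ (⊤ : ℕ∞) (fun p : Pt 2 => p.2 k) D := by
  fun_prop

lemma fderiv_fibre (k : Fin 2) (p u : Pt 2) :
    fderiv ℝ (fun p : Pt 2 => p.2 k) p u = u.2 k := by
  have h := ((ContinuousLinearMap.proj (R := ℝ) (φ := fun _ : Fin 2 => ℂ) k).comp
    (ContinuousLinearMap.snd ℝ (Fin 2 → ℂ) (Fin 2 → ℂ))).hasFDerivAt (x := p)
  exact congrArg (fun φ => φ u) h.fderiv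

lemma fderiv_eta (hL : IsCFM 2 D L) {p : Pt 2} (hp : p ∈ D) (c : ℂ) :
    fderiv ℝ L p (0, c • p.2) = (2 * c.re : ℝ) * L p := by
  have hd : DifferentiableAt ℝ L p :=
    (hL.smooth.contDiffAt (hL.openD.mem_nhds hp)).differentiableAt (by simp)
  have hc : HasDerivAt (fun t : ℝ => ((p.1, (1 + (t : ℂ) * c) • p.2) : Pt 2)) (0, c • p.2) 0 := by
    refine (hasDerivAt_const _ _).prodMk ?_
    have h1 : HasDerivAt (fun t : ℝ => 1 + (t : ℂ) * c) c 0 := by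
      simpa using ((Complex.ofRealCLM.hasDerivAt (x := (0 : ℝ))).mul_const c).const_add 1
    exact h1.smul_const p.2
  have h0 : ((p.1, (1 + ((0 : ℝ) : ℂ) * c) • p.2) : Pt 2) = p := by simp
  have hL1 : HasDerivAt (fun t : ℝ => L (p.1, (1 + (t : ℂ) * c) • p.2))
      (fderiv ℝ L p (0, c • p.2)) 0 := by
    have h := hd.hasFDerivAt
    rw [← h0] at h
    have := h.comp_hasDerivAt (0 : ℝ) hc
    rwa [h0] at this
  have hq : HasDerivAt (fun t : ℝ => ((Complex.normSq (1 + (t : ℂ) * c) : ℝ) : ℂ) * L p)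
      ((2 * c.re : ℝ) * L p) 0 := by
    have h : HasDerivAt (fun t : ℝ => (1 + t * c.re) * (1 + t * c.re) + t * c.im * (t * c.im))
        (2 * c.re) 0 := by
      have h1 : HasDerivAt (fun t : ℝ => 1 + t * c.re) c.re 0 := by
        simpa using ((hasDerivAt_id (0 : ℝ)).mul_const c.re).const_add 1
      have h2 : HasDerivAt (fun t : ℝ => t * c.im) c.im 0 := by
        simpa using (hasDerivAt_id (0 : ℝ)).mul_const c.im
      refine ((h1.mul h1).add (h2.mul h2)).congr_deriv ?_
      simp; ring
    have h' : (fun t : ℝ => Complex.normSq (1 + (t : ℂ) * c)) =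
        fun t : ℝ => (1 + t * c.re) * (1 + t * c.re) + t * c.im * (t * c.im) := by
      ext t; simp [Complex.normSq_apply]
    rw [← h'] at h
    exact h.ofReal_comp.mul_const (L p)
  refine hL1.unique (hq.congr_of_eventuallyEq ?_)
  have hne : ∀ᶠ t : ℝ in nhds 0, 1 + (t : ℂ) * c ≠ 0 := by
    have : ContinuousAt (fun t : ℝ => 1 + (t : ℂ) * c) 0 := by fun_prop
    exact this.eventually_ne (by simp)
  filter_upwards [hne] with t ht
  exact hL.homog p hp _ ht

lemma clm_apply_eq_sum (φ : (Fin 2 → ℂ) →L[ℝ] ℂ) (w : Fin 2 → ℂ) :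
    φ w = ∑ k, (((w k).re : ℂ) * φ (Pi.single k 1) +
      ((w k).im : ℂ) * φ (Pi.single k Complex.I)) := by
  have h : w = ∑ k, ((w k).re • (Pi.single k 1 : Fin 2 → ℂ) +
      (w k).im • (Pi.single k Complex.I : Fin 2 → ℂ)) := by
    ext i
    fin_cases i <;> simp
  conv_lhs => rw [h]
  simp

lemma euler_pointwise (hL : IsCFM 2 D L) {p : Pt 2} (hp : p ∈ D) :
    ∑ k, p.2 k * de L k p = L p := by
  have hφ : ∀ w : Fin 2 → ℂ, fderiv ℝ L p (0, w) = _ := fun w =>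
    clm_apply_eq_sum ((fderiv ℝ L p).comp (ContinuousLinearMap.inr ℝ (Fin 2 → ℂ) (Fin 2 → ℂ))) w
  have h1 := fderiv_eta hL hp 1
  have h2 := fderiv_eta hL hp Complex.I
  rw [hφ] at h1 h2
  simp only [Fin.sum_univ_two, ContinuousLinearMap.comp_apply, ContinuousLinearMap.inr_apply,
    Pi.smul_apply, smul_eq_mul, one_mul, Complex.mul_re, Complex.mul_im, Complex.I_re,
    Complex.I_im, Complex.one_re, zero_mul, zero_sub, zero_add, Complex.ofReal_neg,
    mul_zero, Complex.ofReal_zero, mul_one] at h1 h2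
  have r : ∀ k, p.2 k = ((p.2 k).re : ℂ) + (p.2 k).im * Complex.I := fun k =>
    (Complex.re_add_im _).symm
  simp only [de, Fin.sum_univ_two]
  rw [r 0, r 1]
  push_cast at h1 h2
  linear_combination (1 / 2) * h1 - (Complex.I / 2) * h2 - (1 / 2) *
    ((p.2 0).im * fderiv ℝ L p (0, Pi.single 0 Complex.I) +
      (p.2 1).im * fderiv ℝ L p (0, Pi.single 1 Complex.I)) * Complex.I_sq

lemma det_gmat_ne_zero (hL : IsCFM 2 D L) {p : Pt 2} (hp : p ∈ D) : (gmat L p).det ≠ 0 := by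
  intro h
  obtain ⟨v, hv, hvg⟩ := Matrix.exists_vecMul_eq_zero_iff.mpr h
  have hpos := hL.posdef p hp v hv
  have h0 := congrFun hvg 0
  have h1 := congrFun hvg 1
  simp only [Matrix.vecMul, dotProduct, gmat, Fin.sum_univ_two, Pi.zero_apply] at h0 h1
  have : ∑ i, ∑ j, gm L i j p * v i * (starRingEnd ℂ) (v j) = 0 := by
    simp only [Fin.sum_univ_two]
    linear_combination (starRingEnd ℂ) (v 0) * h0 + (starRingEnd ℂ) (v 1) * h1
  rw [this] at hpos
  simp at hpos

lemma rep_L (hL : IsCFM 2 D L) : Rep L (smoothRestrict L hL.smooth) := rep_smoothRestrict _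

lemma rep_gm (hL : IsCFM 2 D L) (i j : Fin 2) :
    Rep (gm L i j) (deD hL.openD i (debarD hL.openD j (smoothRestrict L hL.smooth))) :=
  ((rep_L hL).debar hL.openD j).de hL.openD i

lemma contDiffOn_gi (hL : IsCFM 2 D L) (l i : Fin 2) :
    ContDiffOn ℝ (⊤ : ℕ∞) (gi L l i) D := by
  have g := rep_gm hL
  have hdet := ((g 0 0).mul (g 1 1)).sub ((g 0 1).mul (g 1 0))
  have hne : ∀ p ∈ D, gm L 0 0 p * gm L 1 1 p - gm L 0 1 p * gm L 1 0 p ≠ 0 := by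
    intro p hp
    have := det_gmat_ne_zero hL hp
    rwa [Matrix.det_fin_two] at this
  have hadj : ContDiffOn ℝ (⊤ : ℕ∞) (fun p => (gmat L p).adjugate l i) D := by
    simp only [Matrix.adjugate_fin_two, gmat]
    fin_cases l <;> fin_cases i
    · exact (g 1 1).contDiffOn
    · exact (g 0 1).neg.contDiffOn
    · exact (g 1 0).neg.contDiffOn
    · exact (g 0 0).contDiffOn
  refine ((hdet.contDiffOn.inv hne).mul hadj).congr fun p hp => ?_
  simp [gi, Matrix.inv_def, Matrix.det_fin_two, gmat]

lemma fibre_sum_gi (hL : IsCFM 2 D L) (i j : Fin 2) {p : Pt 2} (hp : p ∈ D) :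
    ∑ m, gi L m i p * gm L j m p = if j = i then 1 else 0 := by
  have h : gmat L p * (gmat L p)⁻¹ = 1 :=
    Matrix.mul_nonsing_inv _ (isUnit_iff_ne_zero.mpr (det_gmat_ne_zero hL hp))
  have := congrFun (congrFun h j) i
  rw [Matrix.mul_apply, Matrix.one_apply] at this
  rw [← this]
  exact Finset.sum_congr rfl fun m _ => mul_comm _ _

lemma sum_gi_fibre (hL : IsCFM 2 D L) (m l : Fin 2) {p : Pt 2} (hp : p ∈ D) :
    ∑ i, gi L m i p * gm L i l p = if m = l then 1 else 0 := by
  have h : (gmat L p)⁻¹ * gmat L p = 1 :=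
    Matrix.nonsing_inv_mul _ (isUnit_iff_ne_zero.mpr (det_gmat_ne_zero hL hp))
  have := congrFun (congrFun h m) l
  rw [Matrix.mul_apply, Matrix.one_apply] at this
  exact this

lemma Rep.ite_one_zero (q : Prop) [Decidable q] :
    Rep (fun _ : Pt 2 => if q then (1 : ℂ) else 0) (if q then (1 : smoothAlg D) else 0) := by
  split_ifs
  · exact Rep.one
  · exact Rep.zero

/-- The algebraic data of a two-dimensional complex Finsler metric. -/
def finslerAlgebra (hL : IsCFM 2 D L) : FinslerAlgebra (smoothAlg D) where
  cj := smoothConj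
  cj_cj f := by ext; simp [smoothConj]
  a := dzD hL.openD
  ab := dzbarD hL.openD
  v := deD hL.openD
  vb := debarD hL.openD
  cj_a _ _ := smoothConj_wirt _ _ _ _
  cj_v _ _ := smoothConj_wirt _ _ _ _
  a_a _ _ _ := wirt_comm _ _ _ _ _ _
  a_ab _ _ _ := by simp only [dzD, dzbarD, wirtBar_eq, wirt_comm]
  a_v _ _ _ := wirt_comm _ _ _ _ _ _
  a_vb _ _ _ := by
    rw [dzD, debarD, wirtBar_eq]
    exact wirt_comm _ _ _ _ _ _
  ab_v _ _ _ := by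
    rw [deD, dzbarD, wirtBar_eq]
    exact wirt_comm _ _ _ _ _ _
  v_v _ _ _ := wirt_comm _ _ _ _ _ _
  v_vb _ _ _ := by
    rw [deD, debarD, wirtBar_eq]
    exact wirt_comm _ _ _ _ _ _
  e k := smoothRestrict _ (contDiffOn_fibre k)
  a_e j k := by
    rw [Rep.eq_iff ((rep_smoothRestrict (contDiffOn_fibre k)).dz hL.openD j) Rep.zero]
    intro p hp
    simp [dz, fderiv_fibre]
  ab_e j k := by
    rw [Rep.eq_iff ((rep_smoothRestrict (contDiffOn_fibre k)).dzbar hL.openD j) Rep.zero]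
    intro p hp
    simp [dzbar, fderiv_fibre]
  v_e j k := by
    rw [Rep.eq_iff ((rep_smoothRestrict (contDiffOn_fibre k)).de hL.openD j)
      (Rep.ite_one_zero (j = k))]
    intro p hp
    by_cases h : j = k
    · subst h
      simp [de, fderiv_fibre]
      norm_num
    · simp [de, fderiv_fibre, h, Ne.symm h]
  vb_e j k := by
    rw [Rep.eq_iff ((rep_smoothRestrict (contDiffOn_fibre k)).debar hL.openD j) Rep.zero]
    intro p hp
    by_cases h : j = k
    · subst h
      simp [debar, fderiv_fibre]
    · simp [debar, fderiv_fibre, Ne.symm h]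
  L := smoothRestrict L hL.smooth
  cj_L := by
    rw [Rep.eq_iff (rep_L hL).conj (rep_L hL)]
    exact fun p hp => Complex.conj_eq_iff_im.mpr (hL.real_im p hp)
  euler := by
    rw [Rep.eq_iff (Rep.sum fun k => (rep_smoothRestrict (contDiffOn_fibre k)).mul
      ((rep_L hL).de hL.openD k)) (rep_L hL)]
    exact fun p hp => euler_pointwise hL hp
  gi l i := smoothRestrict (gi L l i) (contDiffOn_gi hL l i)
  gi_mul i j := by
    rw [Rep.eq_iff (Rep.sum fun m => (rep_smoothRestrict (contDiffOn_gi hL m i)).mul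
      (rep_gm hL j m)) (Rep.ite_one_zero (j = i))]
    exact fun p hp => fibre_sum_gi hL i j hp
  mul_gi m l := by
    rw [Rep.eq_iff (Rep.sum fun i => (rep_smoothRestrict (contDiffOn_gi hL m i)).mul
      (rep_gm hL i l)) (Rep.ite_one_zero (m = l))]
    exact fun p hp => sum_gi_fibre hL m l hp

lemma FinslerAlgebra.N_eq_sum {R : Type*} [CommRing R] [Algebra ℂ R] (D : FinslerAlgebra R)
    (i k : Fin 2) :
    D.N i k = ∑ m, ∑ l, D.gi m i * D.a k (D.v l (D.vb m D.L)) * D.e l := by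
  refine Finset.sum_congr rfl fun m _ => ?_
  have h := congrArg (D.a k) (D.e_mul_g m)
  simp only [Fin.sum_univ_two, map_add, Derivation.leibniz, D.a_e, smul_eq_mul] at h
  rw [← h, Fin.sum_univ_two]
  ring

lemma eq_zero_of_wirtinger_eq_zero {x y : ℂ} (h : (1 / 2) * (x - Complex.I * y) = 0)
    (h' : (1 / 2) * (x + Complex.I * y) = 0) : x = 0 ∧ y = 0 := by
  refine ⟨by linear_combination h + h', ?_⟩
  linear_combination Complex.I * (h - h') + y * Complex.I_sq

lemma fderiv_eq_zero_of_wirtinger {f : Pt 2 → ℂ} {p : Pt 2} (h₁ : ∀ k, dz f k p = 0)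
    (h₂ : ∀ k, dzbar f k p = 0) (h₃ : ∀ k, de f k p = 0) (h₄ : ∀ k, debar f k p = 0) :
    fderiv ℝ f p = 0 := by
  have hz := clm_apply_eq_sum
    ((fderiv ℝ f p).comp (ContinuousLinearMap.inl ℝ (Fin 2 → ℂ) (Fin 2 → ℂ)))
  have he := clm_apply_eq_sum
    ((fderiv ℝ f p).comp (ContinuousLinearMap.inr ℝ (Fin 2 → ℂ) (Fin 2 → ℂ)))
  simp only [ContinuousLinearMap.comp_apply, ContinuousLinearMap.inl_apply,
    ContinuousLinearMap.inr_apply] at hz he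
  refine ContinuousLinearMap.ext fun ⟨u, w⟩ => ?_
  have huw : ((u, w) : Pt 2) = (u, 0) + (0, w) := by simp
  rw [huw, map_add, hz, he]
  simp only [fun k => (eq_zero_of_wirtinger_eq_zero (h₁ k) (h₂ k)).1,
    fun k => (eq_zero_of_wirtinger_eq_zero (h₁ k) (h₂ k)).2,
    fun k => (eq_zero_of_wirtinger_eq_zero (h₃ k) (h₄ k)).1,
    fun k => (eq_zero_of_wirtinger_eq_zero (h₃ k) (h₄ k)).2]
  simp

variable (hL : IsCFM 2 D L)

lemma rep_e (k : Fin 2) : Rep (fun p : Pt 2 => p.2 k) ((finslerAlgebra hL).e k) :=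
  rep_smoothRestrict (contDiffOn_fibre k)

lemma rep_eb (k : Fin 2) :
    Rep (fun p : Pt 2 => (starRingEnd ℂ) (p.2 k)) ((finslerAlgebra hL).eb k) :=
  (rep_e hL k).conj

lemma rep_gi (l i : Fin 2) : Rep (gi L l i) ((finslerAlgebra hL).gi l i) :=
  rep_smoothRestrict (contDiffOn_gi hL l i)

lemma rep_N (i k : Fin 2) : Rep (Nc L i k) ((finslerAlgebra hL).N i k) := by
  rw [FinslerAlgebra.N_eq_sum]
  exact Rep.sum fun m => Rep.sum fun l =>
    ((rep_gi hL m i).mul ((rep_gm hL l m).dz hL.openD k)).mul (rep_e hL l)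

lemma Rep.del {f : Pt 2 → ℂ} {r : smoothAlg D} (hf : Rep f r) (k : Fin 2) :
    Rep (del L f k) ((finslerAlgebra hL).del k r) := by
  rw [FinslerAlgebra.del_apply]
  exact (hf.dz hL.openD k).sub (Rep.sum fun j => (rep_N hL j k).mul (hf.de hL.openD j))

lemma Rep.delbar {f : Pt 2 → ℂ} {r : smoothAlg D} (hf : Rep f r) (k : Fin 2) :
    Rep (delbar L f k) ((finslerAlgebra hL).delb k r) := by
  rw [FinslerAlgebra.delb_apply]
  exact (hf.dzbar hL.openD k).sub
    (Rep.sum fun j => (rep_N hL j k).conj.mul (hf.debar hL.openD j))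

lemma rep_Γ (i j k : Fin 2) : Rep (Lc L i j k) ((finslerAlgebra hL).Γ i j k) :=
  Rep.sum fun l => (rep_gi hL l i).mul ((rep_gm hL j l).del hL k)

lemma rep_C (i j k : Fin 2) : Rep (Cc L i j k) ((finslerAlgebra hL).C i j k) :=
  Rep.sum fun l => (rep_gi hL l i).mul ((rep_gm hL j l).de hL.openD k)

lemma rep_Rm (r j h k : Fin 2) : Rep (Rh L r j h k) ((finslerAlgebra hL).Rm r j h k) :=
  Rep.sum fun i => (rep_gm hL i r).mul
    (((rep_Γ hL i j k).delbar hL h).neg.sub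
      (Rep.sum fun l => ((rep_N hL l k).delbar hL h).mul (rep_C hL i j l)))

include hL

lemma Fh_ne_zero {p : Pt 2} (hp : p ∈ D) : Fh L p ≠ 0 :=
  Complex.ofReal_ne_zero.mpr (Real.sqrt_pos.mpr (hL.pos p hp)).ne'

lemma contDiffOn_Fh : ContDiffOn ℝ (⊤ : ℕ∞) (Fh L) D :=
  Complex.ofRealCLM.contDiff.comp_contDiffOn
    ((Complex.reCLM.contDiff.comp_contDiffOn hL.smooth).sqrt fun p hp => (hL.pos p hp).ne')

lemma Fh_mul_self {p : Pt 2} (hp : p ∈ D) : Fh L p * Fh L p = L p := by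
  rw [Fh, ← Complex.ofReal_mul, Real.mul_self_sqrt (hL.pos p hp).le]
  exact Complex.ext (by simp) (by simp [hL.real_im p hp])

/-- The horizontal curvature invariant in terms of the spray coefficients. -/
lemma exists_rep_hK : ∃ K Li : smoothAlg D, Rep (hK L) K ∧ (finslerAlgebra hL).L * Li = 1 ∧
    K = -Li ^ 2 * ∑ i, (finslerAlgebra hL).v i (finslerAlgebra hL).L *
      (finslerAlgebra hL).Xb ((finslerAlgebra hL).T i) := by
  have hi : ContDiffOn ℝ (⊤ : ℕ∞) (fun p => 1 / Fh L p) D :=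
    ((contDiffOn_Fh hL).inv fun p hp => Fh_ne_zero hL hp).congr fun p _ => one_div _
  have rF := rep_smoothRestrict (contDiffOn_Fh hL)
  have rFi := rep_smoothRestrict hi
  set F := smoothRestrict (Fh L) (contDiffOn_Fh hL)
  set Fi := smoothRestrict (fun p => 1 / Fh L p) hi
  have hF : F * F = (finslerAlgebra hL).L :=
    ((rF.mul rF).eq_iff (rep_L hL)).mpr fun p hp => Fh_mul_self hL hp
  have hFi : F * Fi = 1 := ((rF.mul rFi).eq_iff Rep.one).mpr fun p hp =>
    mul_one_div_cancel (Fh_ne_zero hL hp)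
  have rup : ∀ i, Rep (lup L i) ((finslerAlgebra hL).e i * Fi) := fun i =>
    ((rep_e hL i).mul rFi).congr fun p _ => div_eq_mul_one_div _ _
  have rlow : ∀ i, Rep (llow L i) ((∑ l, (finslerAlgebra hL).v i ((finslerAlgebra hL).vb l
      (finslerAlgebra hL).L) * (finslerAlgebra hL).eb l) * Fi) := fun i =>
    ((Rep.sum fun l => (rep_gm hL i l).mul (rep_eb hL l)).mul rFi).congr
      fun p _ => div_eq_mul_one_div _ _
  have rJ : Rep (sJ L) _ := Rep.sum fun j => Rep.sum fun k => Rep.sum fun i =>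
    (((rup j).mul (rup k)).mul (rlow i)).mul (rep_Γ hL i j k)
  refine ⟨_, Fi ^ 2, rFi.neg.mul (Rep.sum fun k => (rJ.delbar hL k).mul (rep_eb hL k)), ?_, ?_⟩
  · rw [← hF]
    linear_combination (F * Fi + 1) * hFi
  · exact (finslerAlgebra hL).curvature_eq hF hFi

lemma sum_llow_mul_Cc (j k : Fin 2) {p : Pt 2} (hp : p ∈ D) :
    ∑ h, llow L h p * Cc L h k j p = de (de L k) j p / Fh L p := by
  have hC := ((Rep.sum fun i => ((rep_L hL).de hL.openD i).mul (rep_C hL i k j)).eq_iff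
    (((rep_L hL).de hL.openD k).de hL.openD j)).mp ((finslerAlgebra hL).v_L_mul_C k j) p hp
  have hl : ∀ i, llow L i p = de L i p / Fh L p := fun i => by
    rw [llow, ((Rep.sum fun l => (rep_gm hL i l).mul (rep_eb hL l)).eq_iff
      ((rep_L hL).de hL.openD i)).mp ((finslerAlgebra hL).g_mul_eb i) p hp]
  rw [← hC, Finset.sum_div]
  exact Finset.sum_congr rfl fun i _ => by rw [hl]; ring

lemma sA_eq_zero {p : Pt 2} (hp : p ∈ D) (h : ∀ j k, de (de L k) j p = 0) : sA L p = 0 := by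
  refine Finset.sum_eq_zero fun j _ => Finset.sum_eq_zero fun k _ => ?_
  have := sum_llow_mul_Cc hL j k hp
  rw [h, zero_div] at this
  simp only [mul_assoc, ← Finset.mul_sum, this, mul_zero]

end Metric

/-- connected, weakly Kähler, weak symmetry, `A` nowhere zero imply
that `K` is constant. -/
theorem statement15 (D : Set (Pt 2)) (L : Pt 2 → ℂ) (hL : IsCFM 2 D L)
    (hconn : IsConnected D) (hwK : IsWeaklyKahler L D) (hsym : WeakSym L D)
    (hA : ∀ p ∈ D, sA L p ≠ 0) :
    ∃ c : ℝ, ∀ p ∈ D, hK L p = (c : ℂ) := by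
  obtain ⟨K, Li, rK, hLi, hK⟩ := exists_rep_hK hL
  have hX := (finslerAlgebra hL).X_v_L fun k => ((Rep.sum fun i => Rep.sum fun j => Rep.sum fun l =>
    (((rep_gm hL i l).mul ((rep_Γ hL i j k).sub (rep_Γ hL i k j))).mul (rep_e hL j)).mul
      (rep_eb hL l)).eq_iff Rep.zero).mpr fun p hp => hwK p hp k
  have hS := (finslerAlgebra hL).Xb_T_mul_hess hX fun k =>
    ((Rep.sum fun r => Rep.sum fun h => Rep.sum fun s =>
      (((rep_Rm hL r k h s).mul (rep_eb hL r)).mul (rep_eb hL h)).mul (rep_e hL s)).eq_iff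
    (Rep.sum fun r => Rep.sum fun s => Rep.sum fun h =>
      (((rep_Rm hL r s h k).mul (rep_eb hL r)).mul (rep_e hL s)).mul (rep_eb hL h))).mpr
        fun p hp => hsym p hp k
  have hH : ∀ w, (∀ j k, (finslerAlgebra hL).v j ((finslerAlgebra hL).v k (finslerAlgebra hL).L) *
      w = 0) → w = 0 := by
    intro w hw
    ext ⟨p, hp⟩
    by_contra hwp
    refine hA p hp (sA_eq_zero hL hp fun j k => ?_)
    have h := congrFun (congrArg Subtype.val (hw j k)) ⟨p, hp⟩
    rw [((rep_L hL).de hL.openD k).de hL.openD j p hp]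
    exact (mul_eq_zero.mp h).resolve_right hwp
  have hd : ∀ p ∈ D, fderiv ℝ (CFinsler.hK L) p = 0 := fun p hp =>
    fderiv_eq_zero_of_wirtinger
      (fun k => ((rK.dz hL.openD k).eq_iff Rep.zero).mp
        (FinslerAlgebra.a_K hX hS hH hLi hK k) p hp)
      (fun k => ((rK.dzbar hL.openD k).eq_iff Rep.zero).mp
        (FinslerAlgebra.ab_K hX hS hH hLi hK k) p hp)
      (fun k => ((rK.de hL.openD k).eq_iff Rep.zero).mp
        (FinslerAlgebra.v_K hX hS hH hLi hK k) p hp)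
      (fun k => ((rK.debar hL.openD k).eq_iff Rep.zero).mp
        (FinslerAlgebra.vb_K hX hS hH hLi hK k) p hp)
  have hcj := (rK.conj.eq_iff rK).mp (FinslerAlgebra.cj_K hX hS hH hLi hK)
  obtain ⟨p₀, hp₀⟩ := hconn.nonempty
  refine ⟨(CFinsler.hK L p₀).re, fun p hp => ?_⟩
  rw [Complex.conj_eq_iff_re.mp (hcj p₀ hp₀)]
  exact hL.openD.is_const_of_fderiv_eq_zero hconn.isPreconnected
    (rK.contDiffOn.differentiableOn (by simp)) hd hp hp₀

end CFinsler
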